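/- Let G = ℤ/4ℤ × ℤ/2ℤ. Consider the action of the automorphism group Aut(G) on H^3(G, ℂ^×) in which φ ∈ Aut(G) sends a cohomology class to its pullback along φ (the map induced on group cohomology by φ, with trivial ℂ^×-coefficients). Then this action has exactly 9 orbits; equivalently, the quotient of H^3(G, ℂ^×) by the equivalence relation a ∼ b ⇔ ∃ φ ∈ Aut(G), φ*(a) = b has exactly 9 elements. -/

import Mathlib

/-- `ω : G³ → ℂˣ` is a 3-cocycle on `G`. -/
def IsThreeCocycle {G : Type} [Group G] (ω : G → G → G → ℂˣ) : Prop :=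
  ∀ g h k l : G,
    ω h k l * ω g (h * k) l * ω g h k = ω (g * h) k l * ω g h (k * l)

/-- `β : G³ → ℂˣ` is a 3-coboundary on `G`, i.e. `β = dν` for some 2-cochain
`ν : G² → ℂˣ`. -/
def IsThreeCoboundary {G : Type} [Group G] (β : G → G → G → ℂˣ) : Prop :=
  ∃ ν : G → G → ℂˣ, ∀ g h k : G,
    β g h k = ν h k * ν g (h * k) * (ν (g * h) k)⁻¹ * (ν g h)⁻¹

/-- The relation on 3-cocycles identifying `a` and `b` whenever the pullback
of `a` along some automorphism `φ` of `G` is cohomologous to `b`; the quotient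
of the set of 3-cocycles by (the equivalence closure of) this relation is
exactly the quotient of `H³(G, ℂˣ)` by the pullback action of `Aut(G)`. -/
def AutCohomologousRel {G : Type} [Group G]
    (a b : {ω : G → G → G → ℂˣ // IsThreeCocycle ω}) : Prop :=
  ∃ φ : G ≃* G,
    IsThreeCoboundary (fun g h k => a.1 (φ g) (φ h) (φ k) * (b.1 g h k)⁻¹)

/-! ### Formal computations in the bar complex of `ℤ/4 × ℤ/2`, elements coded by `0,…,7` -/

namespace HThree

/-- Coded multiplication: `a` stands for `(a mod 4, a / 4 mod 2)`. -/
def m (a b : ℕ) : ℕ := (a + b) % 4 + 4 * ((a / 4 + b / 4) % 2)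

/-- A signed term `± g [a|b|c]`. -/
abbrev ZT := Bool × ℕ × ℕ × ℕ × ℕ

abbrev KT := ℕ × ℕ × ℕ

/-- Apply a sign and translate by a group element. -/
def sh (s : Bool) (γ : ℕ) (L : List ZT) : List ZT :=
  L.map fun t => (s == t.1, m γ t.2.1, t.2.2)

def carry (a b : ℕ) : ℕ := (a % 4 + b % 4) / 4
def carry2 (a b : ℕ) : ℕ := (a / 4 + b / 4) / 2

/-- the degree-two homotopy -/
def hh (x y : ℕ) : List ZT :=
  ((List.range (y % 4)).map fun j => (true, 0, x, j + 4 * (y / 4), 1)) ++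
  ((List.range (carry x y * ((x / 4 + y / 4) % 2) * 3)).map fun j => (false, 0, 4, j + 1, 1)) ++
  ((List.range (x % 4 * (y / 4))).map fun i => (false, 0, i + 4 * (x / 4), 1, 4)) ++
  ((List.range (x % 4 * (y / 4))).map fun i => (true, 0, i + 4 * (x / 4), 4, 1))

def g30 : List ZT := [(true, 0, 1, 1, 1), (true, 0, 1, 2, 1), (true, 0, 1, 3, 1)]
def g21 : List ZT := [(true, 0, 1, 1, 4), (false, 0, 1, 4, 1), (true, 0, 2, 1, 4),
  (false, 0, 2, 4, 1), (true, 0, 3, 1, 4), (false, 0, 3, 4, 1), (true, 0, 4, 1, 1),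
  (true, 0, 4, 2, 1), (true, 0, 4, 3, 1)]
def g12 : List ZT := [(true, 0, 1, 4, 4), (false, 0, 4, 1, 4), (true, 0, 4, 4, 1)]
def g03 : List ZT := [(true, 0, 4, 4, 4)]

def f30 (x y z : ℕ) : List ℕ :=
  (List.range (x % 4 * carry y z)).map fun i => i + 4 * ((x / 4 + y / 4 + z / 4) % 2)
def f21 (x y z : ℕ) : List ℕ :=
  (List.range (carry x y * (z / 4))).map fun _ => 4 * ((x / 4 + y / 4) % 2)
def f12 (x y z : ℕ) : List ℕ :=
  (List.range (x % 4 * carry2 y z)).map fun i => i + 4 * (x / 4)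
def f03 (x y z : ℕ) : List ℕ :=
  (List.range (x / 4 * carry2 y z)).map fun _ => 0

def zz (x y z : ℕ) : List ZT :=
  (true, 0, x, y, z) ::
  ((f30 x y z).flatMap (fun γ => sh false γ g30) ++
  ((f21 x y z).flatMap (fun γ => sh false γ g21) ++
  ((f12 x y z).flatMap (fun γ => sh false γ g12) ++
  ((f03 x y z).flatMap (fun γ => sh false γ g03) ++
  (sh false x (hh y z) ++ (sh true 0 (hh (m x y) z) ++
  (sh false 0 (hh x (m y z)) ++ sh true 0 (hh x y))))))))

/-- the part of the boundary of `[g|a|b|c]` other than `g[a|b|c]`; positive terms. -/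
def pos1 (g a b c : ℕ) : List KT := [(g, m a b, c), (g, a, b)]
def neg1 (g a b c : ℕ) : List KT := [(m g a, b, c), (g, a, m b c)]

def nd (t : KT) : Bool := !(Nat.beq t.1 0) && (!(Nat.beq t.2.1 0) && !(Nat.beq t.2.2 0))

def posL (L : List ZT) : List KT :=
  L.flatMap fun t => if t.1 then pos1 t.2.1 t.2.2.1 t.2.2.2.1 t.2.2.2.2
    else neg1 t.2.1 t.2.2.1 t.2.2.2.1 t.2.2.2.2
def negL (L : List ZT) : List KT :=
  L.flatMap fun t => if t.1 then neg1 t.2.1 t.2.2.1 t.2.2.2.1 t.2.2.2.2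
    else pos1 t.2.1 t.2.2.1 t.2.2.2.1 t.2.2.2.2

def eqT (s t : KT) : Bool := Nat.beq s.1 t.1 && (Nat.beq s.2.1 t.2.1 && Nat.beq s.2.2 t.2.2)

def rm (t : KT) : List KT → Option (List KT)
  | [] => none
  | u :: l => bif eqT t u then some l else (rm t l).map (u :: ·)

def perm : List KT → List KT → Bool
  | [], l => l.isEmpty
  | t :: r, l => match rm t l with
    | none => false
    | some l' => perm r l'

def chk (x y z : ℕ) : Bool := perm ((posL (zz x y z)).filter nd) ((negL (zz x y z)).filter nd)

def allB (p : ℕ → Bool) : Bool := p 0 && p 1 && p 2 && p 3 && p 4 && p 5 && p 6 && p 7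

theorem chk_all : (allB fun x => allB fun y => allB fun z => chk x y z) = true := by
  decide +kernel

theorem allB_spec {p : ℕ → Bool} (h : allB p = true) : ∀ x < 8, p x = true := by
  intro x hx
  simp only [allB, Bool.and_eq_true] at h
  interval_cases x <;> simp [h]

section sound

variable {A : Type} [AddCommGroup A]

def sg (s : Bool) (a : A) : A := bif s then a else -a

def ev (w : ℕ → ℕ → ℕ → A) (L : List ZT) : A :=
  (L.map fun t => sg t.1 (w t.2.2.1 t.2.2.2.1 t.2.2.2.2)).sum

def evK (w : ℕ → ℕ → ℕ → A) (L : List KT) : A := (L.map fun t => w t.1 t.2.1 t.2.2).sum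

theorem ev_append (w : ℕ → ℕ → ℕ → A) (L M : List ZT) : ev w (L ++ M) = ev w L + ev w M := by
  simp [ev]

theorem ev_cons (w : ℕ → ℕ → ℕ → A) (t : ZT) (M : List ZT) :
    ev w (t :: M) = sg t.1 (w t.2.2.1 t.2.2.2.1 t.2.2.2.2) + ev w M := by
  simp [ev]

theorem ev_sh (w : ℕ → ℕ → ℕ → A) (s : Bool) (γ : ℕ) (L : List ZT) :
    ev w (sh s γ L) = sg s (ev w L) := by
  induction L with
  | nil => cases s <;> simp [sh, ev, sg]
  | cons t L ih =>
    have : sh s γ (t :: L) = (s == t.1, m γ t.2.1, t.2.2) :: sh s γ L := rfl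
    rw [this, ev_cons, ih, ev_cons]
    rcases t with ⟨b, t⟩
    cases s <;> cases b <;> simp [sg, add_comm]

theorem ev_flat (w : ℕ → ℕ → ℕ → A) (L : List ℕ) (M : List ZT) :
    ev w (L.flatMap fun γ => sh false γ M) = - (L.length • ev w M) := by
  induction L with
  | nil => simp [ev]
  | cons γ L ih =>
    rw [List.flatMap_cons, ev_append, ih, ev_sh, List.length_cons, succ_nsmul]
    simp [sg, add_comm]

theorem rm_sound (w : ℕ → ℕ → ℕ → A) (t : KT) (l l' : List KT) (h : rm t l = some l') :
    evK w l = w t.1 t.2.1 t.2.2 + evK w l' := by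
  induction l generalizing l' with
  | nil => simp [rm] at h
  | cons u l ih =>
    rw [rm] at h
    cases hb : eqT t u with
    | true =>
      rw [hb] at h
      simp only [cond_true, Option.some.injEq] at h
      subst h
      simp only [eqT, Bool.and_eq_true, Nat.beq_eq] at hb
      obtain ⟨h1, h2, h3⟩ := hb
      simp [evK, h1, h2, h3]
    | false =>
      rw [hb] at h
      simp only [cond_false, Option.map_eq_some_iff] at h
      obtain ⟨l'', h1, h2⟩ := h
      have := ih _ h1
      subst h2
      simp only [evK, List.map_cons, List.sum_cons] at this ⊢
      rw [this]; abel

theorem perm_sound (w : ℕ → ℕ → ℕ → A) (l l' : List KT) (h : perm l l' = true) :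
    evK w l = evK w l' := by
  induction l generalizing l' with
  | nil =>
    simp only [perm, List.isEmpty_iff] at h
    rw [h]
  | cons t l ih =>
    rw [perm] at h
    cases hr : rm t l' with
    | none => rw [hr] at h; simp at h
    | some l'' =>
      rw [hr] at h
      rw [rm_sound w t l' l'' hr, ← ih l'' h]
      simp [evK]

theorem filter_sound (w : ℕ → ℕ → ℕ → A) (h1 : ∀ a b, w 0 a b = 0) (h2 : ∀ a b, w a 0 b = 0)
    (h3 : ∀ a b, w a b 0 = 0) (l : List KT) : evK w (l.filter nd) = evK w l := by
  induction l with
  | nil => rfl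
  | cons t l ih =>
    rw [List.filter_cons]
    split_ifs with h
    · simp only [evK, List.map_cons, List.sum_cons] at ih ⊢
      rw [ih]
    · have : w t.1 t.2.1 t.2.2 = 0 := by
        simp only [nd, Bool.and_eq_true, Bool.not_eq_true', not_and,
          ← Bool.not_eq_true] at h
        by_cases ha : t.1 = 0
        · rw [ha, h1]
        by_cases hb : t.2.1 = 0
        · rw [hb, h2]
        by_cases hc : t.2.2 = 0
        · rw [hc, h3]
        exact absurd hc (by simpa [ha, hb] using h)
      rw [ih]
      simp [evK, this]

theorem bdry_sound (w : ℕ → ℕ → ℕ → A)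
    (hw : ∀ a b c d, w b c d + w a (m b c) d + w a b c = w (m a b) c d + w a b (m c d))
    (L : List ZT) : ev w L + evK w (posL L) = evK w (negL L) := by
  induction L with
  | nil => simp [ev, evK, posL, negL]
  | cons t L ih =>
    obtain ⟨s, g, a, b, c⟩ := t
    have e1 : ∀ l l' : List KT, evK w (l ++ l') = evK w l + evK w l' := by
      intro l l'; simp [evK]
    have h := hw g a b c
    rw [ev_cons]
    cases s
    · have hp : posL ((false, g, a, b, c) :: L) = neg1 g a b c ++ posL L := rfl
      have hn : negL ((false, g, a, b, c) :: L) = pos1 g a b c ++ negL L := rfl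
      rw [hp, hn, e1, e1, ← ih]
      simp only [evK, neg1, pos1, List.map_cons, List.sum_cons, List.map_nil, List.sum_nil, sg,
        cond_false, add_zero, ← h]
      abel
    · have hp : posL ((true, g, a, b, c) :: L) = pos1 g a b c ++ posL L := rfl
      have hn : negL ((true, g, a, b, c) :: L) = neg1 g a b c ++ negL L := rfl
      rw [hp, hn, e1, e1, ← ih]
      simp only [evK, neg1, pos1, List.map_cons, List.sum_cons, List.map_nil, List.sum_nil, sg,
        cond_true, add_zero, ← h]
      abel

/-- Any normalized cocycle is, up to an explicit coboundary, a combination of four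
standard cochains. -/
theorem main_identity (w : ℕ → ℕ → ℕ → A) (h1 : ∀ a b, w 0 a b = 0) (h2 : ∀ a b, w a 0 b = 0)
    (h3 : ∀ a b, w a b 0 = 0)
    (hw : ∀ a b c d, w b c d + w a (m b c) d + w a b c = w (m a b) c d + w a b (m c d))
    (x y z : ℕ) (hx : x < 8) (hy : y < 8) (hz : z < 8) :
    w x y z = (x % 4 * carry y z) • ev w g30 + (carry x y * (z / 4)) • ev w g21
      + (x % 4 * carry2 y z) • ev w g12 + (x / 4 * carry2 y z) • ev w g03
      + (ev w (hh y z) + ev w (hh x (m y z)) - ev w (hh (m x y) z) - ev w (hh x y)) := by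
  have hc := allB_spec (allB_spec (allB_spec chk_all x hx) y hy) z hz
  have hp := perm_sound w _ _ hc
  rw [filter_sound w h1 h2 h3, filter_sound w h1 h2 h3] at hp
  have hb := bdry_sound w hw (zz x y z)
  rw [hp] at hb
  have h0 : ev w (zz x y z) = 0 := by simpa using hb
  simp only [zz, ev_cons, ev_append, ev_flat, ev_sh, sg, cond_true, cond_false, f30, f21, f12, f03,
    List.length_map, List.length_range] at h0
  rw [← sub_eq_zero, ← h0]
  abel

end sound

/-! ### Transfer to the group -/

abbrev G := Multiplicative (ZMod 4 × ZMod 2)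

def dec (n : ℕ) : G := Multiplicative.ofAdd ((n : ZMod 4), ((n / 4 : ℕ) : ZMod 2))
def enc (g : G) : ℕ := (Multiplicative.toAdd g).1.val + 4 * (Multiplicative.toAdd g).2.val

theorem dec_enc : ∀ g : G, dec (enc g) = g := by decide
theorem enc_lt : ∀ g : G, enc g < 8 := by decide
theorem enc_mul : ∀ g h : G, enc (g * h) = m (enc g) (enc h) := by decide
theorem dec_zero : dec 0 = 1 := by decide

theorem dec_m (a b : ℕ) : dec (m a b) = dec a * dec b := by
  have h : (m a b) / 4 = (a / 4 + b / 4) % 2 := by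
    unfold m; omega
  have h2 : ((m a b : ℕ) : ZMod 4) = (a : ZMod 4) + b := by
    rw [← Nat.cast_add, ZMod.natCast_eq_natCast_iff]
    unfold m Nat.ModEq; omega
  have h3 : (((a / 4 + b / 4) % 2 : ℕ) : ZMod 2) = ((a / 4 : ℕ) : ZMod 2) + ((b / 4 : ℕ) : ZMod 2) := by
    rw [← Nat.cast_add, ZMod.natCast_eq_natCast_iff]
    unfold Nat.ModEq; omega
  unfold dec
  rw [h, h2, h3]
  rfl

/-- The four standard cochains (exponents). -/
def E30 (x y z : G) : ℕ := enc x % 4 * carry (enc y) (enc z)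
def E21 (x y z : G) : ℕ := carry (enc x) (enc y) * (enc z / 4)
def E12 (x y z : G) : ℕ := enc x % 4 * carry2 (enc y) (enc z)
def E03 (x y z : G) : ℕ := enc x / 4 * carry2 (enc y) (enc z)

/-- cohomologous -/
def Coh (a b : G → G → G → ℂˣ) : Prop := IsThreeCoboundary fun g h k => a g h k * (b g h k)⁻¹

theorem Coh.symm {a b : G → G → G → ℂˣ} (h : Coh a b) : Coh b a := by
  obtain ⟨ν, hν⟩ := h
  refine ⟨fun g h => (ν g h)⁻¹, fun g h k => ?_⟩
  have := congrArg (·⁻¹) (hν g h k)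
  simp only [mul_inv_rev, inv_inv] at this ⊢
  rw [this]
  simp only [mul_comm, mul_left_comm]

theorem Coh.trans {a b c : G → G → G → ℂˣ} (h : Coh a b) (h' : Coh b c) : Coh a c := by
  obtain ⟨ν, hν⟩ := h
  obtain ⟨μ, hμ⟩ := h'
  refine ⟨fun g h => ν g h * μ g h, fun g h k => ?_⟩
  have e : a g h k * (c g h k)⁻¹ = (a g h k * (b g h k)⁻¹) * (b g h k * (c g h k)⁻¹) := by group
  have e1 := hν g h k
  have e2 := hμ g h k
  simp only at e1 e2 ⊢
  rw [e, e1, e2]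
  apply Additive.ofMul.injective
  simp only [ofMul_mul, ofMul_inv]
  abel

theorem cocycle_of_coh {a b : G → G → G → ℂˣ} (ha : IsThreeCocycle a) (h : Coh a b) :
    IsThreeCocycle b := by
  obtain ⟨ν, hν⟩ := h
  have hb : ∀ g h k, b g h k =
      a g h k * (ν h k * ν g (h * k) * (ν (g * h) k)⁻¹ * (ν g h)⁻¹)⁻¹ := by
    intro g h k
    rw [← hν g h k]
    apply Additive.ofMul.injective
    simp only [ofMul_mul, ofMul_inv]
    abel
  intro g h k l
  have e := congrArg Additive.ofMul (ha g h k l)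
  apply Additive.ofMul.injective
  simp only [hb, ofMul_mul, ofMul_inv, mul_assoc] at e ⊢
  rw [← sub_eq_zero] at e ⊢
  rw [← e]
  abel

theorem normalize (ω : G → G → G → ℂˣ) (hω : IsThreeCocycle ω) :
    ∃ ω', Coh ω ω' ∧ IsThreeCocycle ω' ∧ (∀ a b, ω' 1 a b = 1) ∧ (∀ a b, ω' a 1 b = 1) ∧
      (∀ a b, ω' a b 1 = 1) := by
  have h111 : ω 1 1 1 = 1 := by simpa using hω 1 1 1 1
  let ν : G → G → ℂˣ := fun g h => if g = 1 then ω 1 1 h else if h = 1 then (ω g 1 1)⁻¹ else 1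
  have hν1 : ∀ h, ν 1 h = ω 1 1 h := fun h => by simp [ν]
  have hν2 : ∀ g, ν g 1 = (ω g 1 1)⁻¹ := fun g => by
    by_cases hg : g = 1
    · simp [ν, hg, h111]
    · simp [ν, hg]
  let ω' : G → G → G → ℂˣ := fun g h k =>
    ω g h k * (ν h k * ν g (h * k) * (ν (g * h) k)⁻¹ * (ν g h)⁻¹)⁻¹
  have hcoh : Coh ω ω' := ⟨ν, fun g h k => by
    apply Additive.ofMul.injective
    simp only [ω', ofMul_mul, ofMul_inv]
    abel⟩
  have hc := cocycle_of_coh hω hcoh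
  have hmid : ∀ a b, ω' a 1 b = 1 := by
    intro a b
    have := hω a 1 1 b
    simp only [mul_one, one_mul] at this
    have h2 : ω a 1 b = ω 1 1 b * ω a 1 1 := by
      have : ω a 1 b * (ω 1 1 b * ω a 1 1) = ω a 1 b * ω a 1 b := by
        rw [← this]; simp only [mul_comm, mul_left_comm]
      exact (mul_left_cancel this).symm
    simp only [ω', mul_one, one_mul, hν1, hν2, h2]
    simp only [mul_inv_rev, inv_inv]
    group
  refine ⟨ω', hcoh, hc, fun a b => ?_, hmid, fun a b => ?_⟩
  · have := hc 1 1 a b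
    simpa [hmid] using this
  · have := hc a b 1 1
    simp only [mul_one, hmid] at this
    simpa using this

def P (c30 c21 c12 c03 : ℂˣ) : G → G → G → ℂˣ := fun x y z =>
  c30 ^ E30 x y z * c21 ^ E21 x y z * c12 ^ E12 x y z * c03 ^ E03 x y z

theorem exists_P (ω : G → G → G → ℂˣ) (hω : IsThreeCocycle ω) :
    ∃ c30 c21 c12 c03, Coh ω (P c30 c21 c12 c03) := by
  obtain ⟨ω', hcoh, hc, h1, h2, h3⟩ := normalize ω hω
  let w : ℕ → ℕ → ℕ → Additive ℂˣ := fun a b c => Additive.ofMul (ω' (dec a) (dec b) (dec c))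
  have key := main_identity w (fun a b => by simp [w, dec_zero, h1])
    (fun a b => by simp [w, dec_zero, h2]) (fun a b => by simp [w, dec_zero, h3])
    (fun a b c d => by
      have := congrArg Additive.ofMul (hc (dec a) (dec b) (dec c) (dec d))
      simpa only [w, dec_m, ofMul_mul] using this)
  refine ⟨(ev w g30).toMul, (ev w g21).toMul, (ev w g12).toMul, (ev w g03).toMul,
    hcoh.trans ⟨fun x y => (ev w (hh (enc x) (enc y))).toMul, fun x y z => ?_⟩⟩
  have := key (enc x) (enc y) (enc z) (enc_lt x) (enc_lt y) (enc_lt z)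
  apply Additive.ofMul.injective
  simp only [w, dec_enc] at this
  rw [ofMul_mul, this]
  simp only [P, E30, E21, E12, E03, enc_mul, ofMul_mul, ofMul_inv, ofMul_pow, ofMul_toMul]
  abel

/-! ### Standard cocycles -/

/-- the imaginary unit as a unit -/
noncomputable def ζ : ℂˣ := Units.mk0 Complex.I Complex.I_ne_zero

theorem ζ_sq : ζ ^ 2 = -1 := by
  ext; simp [ζ]

theorem ζ_four : ζ ^ 4 = 1 := by
  ext; simp [ζ]

theorem ζ_mod (n : ℕ) : ζ ^ n = ζ ^ (n % 4) := by
  conv_lhs => rw [← Nat.div_add_mod n 4, pow_add, pow_mul, ζ_four, one_pow, one_mul]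

theorem ζ_congr {a b : ℕ} (h : a % 4 = b % 4) : ζ ^ a = ζ ^ b := by
  rw [ζ_mod a, ζ_mod b, h]

theorem ζ_order : orderOf ζ = 4 := by
  have : Fact (Nat.Prime 2) := ⟨Nat.prime_two⟩
  have h := orderOf_eq_prime_pow (p := 2) (n := 1) (x := ζ) (by
    rw [pow_one, ζ_sq]
    intro h
    have := congrArg Units.val h
    norm_num at this) (by rw [show 2 ^ (1 + 1) = 4 from rfl, ζ_four])
  simpa using h

theorem ζ_inj {a b : ℕ} (h : ζ ^ a = ζ ^ b) : a % 4 = b % 4 := by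
  have := pow_eq_pow_iff_modEq.mp h
  rwa [ζ_order] at this

theorem sq_one (u : ℂˣ) (h : u ^ 2 = 1) : ∃ b : Fin 2, u = ζ ^ (2 * b.val) := by
  have h' : (u : ℂ) ^ 2 = 1 := by rw [← Units.val_pow_eq_pow_val, h, Units.val_one]
  rw [sq] at h'
  rcases mul_self_eq_one_iff.mp h' with h1 | h1
  · exact ⟨0, by ext; simp [h1]⟩
  · exact ⟨1, by ext; simp [h1, ζ]⟩

theorem four_one (u : ℂˣ) (h : u ^ 4 = 1) : ∃ a : Fin 4, u = ζ ^ a.val := by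
  obtain ⟨b, hb⟩ := sq_one (u ^ 2) (by rw [← pow_mul, h])
  obtain ⟨c, hc⟩ := sq_one (u * (ζ ^ b.val)⁻¹) (by
    rw [mul_pow, hb, inv_pow, ← pow_mul, mul_comm 2, mul_inv_cancel])
  have hu : u = ζ ^ (2 * c.val + b.val) := by
    rw [pow_add, ← hc, inv_mul_cancel_right]
  exact ⟨⟨(2 * c.val + b.val) % 4, Nat.mod_lt _ (by norm_num)⟩, by rw [hu]; exact ζ_mod _⟩

abbrev Param := Fin 4 × Fin 2 × Fin 2

/-- exponent of the standard cocycle -/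
def X (p : Param) (x y z : G) : ℕ :=
  p.1.val * E30 x y z + 2 * p.2.1.val * E03 x y z + 2 * p.2.2.val * E21 x y z

noncomputable def std (p : Param) : G → G → G → ℂˣ := fun x y z => ζ ^ X p x y z

theorem P_std (p : Param) :
    P (ζ ^ p.1.val) (ζ ^ (2 * p.2.2.val)) 1 (ζ ^ (2 * p.2.1.val)) = std p := by
  funext x y z
  simp only [P, std, X, one_pow, mul_one, ← pow_mul, ← pow_add]
  congr 1
  ring

/-- coded cocycle check -/
def cocB (n : ℕ) (E : ℕ → ℕ → ℕ → ℕ) : Bool :=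
  allB fun g => allB fun h => allB fun k => allB fun l =>
    Nat.beq ((E h k l + E g (m h k) l + E g h k) % n) ((E (m g h) k l + E g h (m k l)) % n)

theorem coc30 : cocB 4 (fun x y z => x % 4 * carry y z) = true := by decide +kernel
theorem coc21 : cocB 2 (fun x y z => carry x y * (z / 4)) = true := by decide +kernel
theorem coc03 : cocB 2 (fun x y z => x / 4 * carry2 y z) = true := by decide +kernel

theorem cocB_spec {n : ℕ} {E : ℕ → ℕ → ℕ → ℕ} (h : cocB n E = true) (g h' k l : G) :
    (E (enc h') (enc k) (enc l) + E (enc g) (enc (h' * k)) (enc l) + E (enc g) (enc h') (enc k)) % n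
    = (E (enc (g * h')) (enc k) (enc l) + E (enc g) (enc h') (enc (k * l))) % n := by
  have := allB_spec (allB_spec (allB_spec (allB_spec h _ (enc_lt g)) _ (enc_lt h')) _ (enc_lt k)) _
    (enc_lt l)
  rw [enc_mul, enc_mul, enc_mul]
  exact Nat.eq_of_beq_eq_true this

theorem std_cocycle (p : Param) : IsThreeCocycle (std p) := by
  intro g h k l
  simp only [std, ← pow_add]
  apply ζ_congr
  have h1 := cocB_spec coc30 g h k l
  have h2 := cocB_spec coc21 g h k l
  have h3 := cocB_spec coc03 g h k l
  have h1' : (E30 h k l + E30 g (h * k) l + E30 g h k) ≡ (E30 (g * h) k l + E30 g h (k * l)) [MOD 4] :=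
    h1
  have h2' : 2 * (E21 h k l + E21 g (h * k) l + E21 g h k) ≡
      2 * (E21 (g * h) k l + E21 g h (k * l)) [MOD 2 * 2] := Nat.ModEq.mul_left' 2 h2
  have h3' : 2 * (E03 h k l + E03 g (h * k) l + E03 g h k) ≡
      2 * (E03 (g * h) k l + E03 g h (k * l)) [MOD 2 * 2] := Nat.ModEq.mul_left' 2 h3
  have := ((h1'.mul_left p.1.val).add (h3'.mul_left p.2.1.val)).add (h2'.mul_left p.2.2.val)
  unfold X
  change _ ≡ _ [MOD 4]
  convert this using 1 <;> ring

def bB : Bool := allB fun x => allB fun y => allB fun z =>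
  Nat.beq (y % 4 * (z / 4) + x % 4 * (m y z / 4) + 2 * (x % 4 * carry2 y z))
    (m x y % 4 * (z / 4) + x % 4 * (y / 4) + 4 * (carry x y * (z / 4)))

theorem bB_true : bB = true := by decide +kernel

theorem coh_b_aux (c30 c21 b c03 : ℂˣ) (p r n1 n2 n3 n4 n5 n6 : ℕ)
    (h : n1 + n2 + 2 * n3 = n4 + n5 + 4 * n6) :
    c30 ^ p * c21 ^ n6 * (b ^ 2) ^ n3 * c03 ^ r *
      (c30 ^ p * (c21 * b ^ 4) ^ n6 * 1 ^ n3 * c03 ^ r)⁻¹ =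
    (b ^ n1)⁻¹ * (b ^ n2)⁻¹ * ((b ^ n4)⁻¹)⁻¹ * ((b ^ n5)⁻¹)⁻¹ := by
  have h' := congrArg (fun n => b ^ n) h
  simp only [pow_add, pow_mul] at h'
  rw [mul_pow, one_pow, mul_one, inv_inv, inv_inv]
  generalize c30 ^ p = u1 at *
  generalize c21 ^ n6 = u2 at *
  generalize c03 ^ r = u3 at *
  generalize (b ^ 2) ^ n3 = u4 at *
  generalize (b ^ 4) ^ n6 = u5 at *
  generalize b ^ n1 = v1 at *
  generalize b ^ n2 = v2 at *
  generalize b ^ n4 = v4 at *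
  generalize b ^ n5 = v5 at *
  have e := congrArg Additive.ofMul h'
  apply Additive.ofMul.injective
  simp only [ofMul_mul, ofMul_inv] at e ⊢
  rw [← sub_eq_zero] at e ⊢
  rw [← e]
  abel

theorem coh_b (c30 c21 b c03 : ℂˣ) :
    Coh (P c30 c21 (b ^ 2) c03) (P c30 (c21 * b ^ 4) 1 c03) := by
  refine ⟨fun x y => (b ^ (enc x % 4 * (enc y / 4)))⁻¹, fun x y z => ?_⟩
  have h := Nat.eq_of_beq_eq_true
    (allB_spec (allB_spec (allB_spec bB_true _ (enc_lt x)) _ (enc_lt y)) _ (enc_lt z))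
  simp only [P, E30, E21, E12, E03, enc_mul]
  exact coh_b_aux _ _ _ _ _ _ _ _ _ _ _ _ h

theorem exists_std (ω : G → G → G → ℂˣ) (hω : IsThreeCocycle ω) : ∃ p, Coh ω (std p) := by
  obtain ⟨c30, c21, c12, c03, hP⟩ := exists_P ω hω
  have hc := cocycle_of_coh hω hP
  have e1 : c30 ^ 4 = 1 := by
    have := hc (dec 1) (dec 3) (dec 1) (dec 3)
    have n1 : E30 (dec 3) (dec 1) (dec 3) = 3 := by decide
    simpa [P, n1, show E21 (dec 3) (dec 1) (dec 3) = 0 by decide,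
      show E12 (dec 3) (dec 1) (dec 3) = 0 by decide,
      show E03 (dec 3) (dec 1) (dec 3) = 0 by decide,
      show E30 (dec 1) (dec 3 * dec 1) (dec 3) = 0 by decide,
      show E21 (dec 1) (dec 3 * dec 1) (dec 3) = 0 by decide,
      show E12 (dec 1) (dec 3 * dec 1) (dec 3) = 0 by decide,
      show E03 (dec 1) (dec 3 * dec 1) (dec 3) = 0 by decide,
      show E30 (dec 1) (dec 3) (dec 1) = 1 by decide,
      show E21 (dec 1) (dec 3) (dec 1) = 0 by decide,
      show E12 (dec 1) (dec 3) (dec 1) = 0 by decide,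
      show E03 (dec 1) (dec 3) (dec 1) = 0 by decide,
      show E30 (dec 1 * dec 3) (dec 1) (dec 3) = 0 by decide,
      show E21 (dec 1 * dec 3) (dec 1) (dec 3) = 0 by decide,
      show E12 (dec 1 * dec 3) (dec 1) (dec 3) = 0 by decide,
      show E03 (dec 1 * dec 3) (dec 1) (dec 3) = 0 by decide,
      show E30 (dec 1) (dec 3) (dec 1 * dec 3) = 0 by decide,
      show E21 (dec 1) (dec 3) (dec 1 * dec 3) = 0 by decide,
      show E12 (dec 1) (dec 3) (dec 1 * dec 3) = 0 by decide,
      show E03 (dec 1) (dec 3) (dec 1 * dec 3) = 0 by decide, ← pow_succ] using this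
  have e2 : c03 ^ 2 = 1 := by
    have := hc (dec 4) (dec 4) (dec 4) (dec 4)
    simpa [P, show dec 4 * dec 4 = 1 by decide,
      show E30 (dec 4) (dec 4) (dec 4) = 0 by decide,
      show E21 (dec 4) (dec 4) (dec 4) = 0 by decide,
      show E12 (dec 4) (dec 4) (dec 4) = 0 by decide,
      show E03 (dec 4) (dec 4) (dec 4) = 1 by decide,
      show E30 (dec 4) 1 (dec 4) = 0 by decide,
      show E21 (dec 4) 1 (dec 4) = 0 by decide,
      show E12 (dec 4) 1 (dec 4) = 0 by decide,
      show E03 (dec 4) 1 (dec 4) = 0 by decide,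
      show E30 1 (dec 4) (dec 4) = 0 by decide,
      show E21 1 (dec 4) (dec 4) = 0 by decide,
      show E12 1 (dec 4) (dec 4) = 0 by decide,
      show E03 1 (dec 4) (dec 4) = 0 by decide,
      show E30 (dec 4) (dec 4) 1 = 0 by decide,
      show E21 (dec 4) (dec 4) 1 = 0 by decide,
      show E12 (dec 4) (dec 4) 1 = 0 by decide,
      show E03 (dec 4) (dec 4) 1 = 0 by decide, ← pow_two] using this
  have e3 : c12 ^ 4 * c21 ^ 2 = 1 := by
    have := hc (dec 1) (dec 3) (dec 4) (dec 4)
    simp [P, show dec 1 * dec 3 = 1 by decide, show dec 4 * dec 4 = 1 by decide,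
      show dec 3 * dec 4 = dec 7 by decide,
      show E30 (dec 3) (dec 4) (dec 4) = 0 by decide,
      show E21 (dec 3) (dec 4) (dec 4) = 0 by decide,
      show E12 (dec 3) (dec 4) (dec 4) = 3 by decide,
      show E03 (dec 3) (dec 4) (dec 4) = 0 by decide,
      show E30 (dec 1) (dec 7) (dec 4) = 0 by decide,
      show E21 (dec 1) (dec 7) (dec 4) = 1 by decide,
      show E12 (dec 1) (dec 7) (dec 4) = 1 by decide,
      show E03 (dec 1) (dec 7) (dec 4) = 0 by decide,
      show E30 (dec 1) (dec 3) (dec 4) = 0 by decide,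
      show E21 (dec 1) (dec 3) (dec 4) = 1 by decide,
      show E12 (dec 1) (dec 3) (dec 4) = 0 by decide,
      show E03 (dec 1) (dec 3) (dec 4) = 0 by decide,
      show E30 1 (dec 4) (dec 4) = 0 by decide,
      show E21 1 (dec 4) (dec 4) = 0 by decide,
      show E12 1 (dec 4) (dec 4) = 0 by decide,
      show E03 1 (dec 4) (dec 4) = 0 by decide,
      show E30 (dec 1) (dec 3) 1 = 0 by decide,
      show E21 (dec 1) (dec 3) 1 = 0 by decide,
      show E12 (dec 1) (dec 3) 1 = 0 by decide,
      show E03 (dec 1) (dec 3) 1 = 0 by decide] at this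
    rw [← this]
    apply Additive.ofMul.injective
    simp only [ofMul_mul, ofMul_pow]
    abel
  obtain ⟨b, hb⟩ : ∃ b : ℂˣ, b ^ 2 = c12 := by
    obtain ⟨z, hz⟩ := IsAlgClosed.exists_pow_nat_eq (c12 : ℂ) (n := 2) (by norm_num)
    have hz0 : z ≠ 0 := by
      rintro rfl
      exact c12.ne_zero (by rw [← hz]; norm_num)
    exact ⟨Units.mk0 z hz0, by ext; simpa using hz⟩
  subst hb
  obtain ⟨a, rfl⟩ := four_one c30 e1
  obtain ⟨u, rfl⟩ := sq_one c03 e2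
  obtain ⟨v, hv⟩ := sq_one (c21 * b ^ 4) (by
    rw [← e3]
    apply Additive.ofMul.injective
    simp only [ofMul_mul, ofMul_pow]
    abel)
  refine ⟨(a, u, v), hP.trans ?_⟩
  rw [← P_std]
  have := coh_b (ζ ^ a.val) c21 b (ζ ^ (2 * u.val))
  rwa [hv] at this

/-! ### Invariants -/

/-- invariant attached to the cyclic subgroup generated by `g` -/
noncomputable def kk (ω : G → G → G → ℂˣ) (g : G) : ℂˣ :=
  if g * g = 1 then ω g 1 g * ω g g g
  else ω g 1 g * ω g g g * ω g (g * g) g * ω g (g * g * g) g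

theorem pow4 : ∀ g : G, g * (g * (g * g)) = 1 := by decide

theorem kk_coh {a b : G → G → G → ℂˣ} (h : Coh a b) (g : G) : kk a g = kk b g := by
  obtain ⟨ν, hν⟩ := h
  have hb : ∀ g h k, a g h k =
      b g h k * (ν h k * ν g (h * k) * (ν (g * h) k)⁻¹ * (ν g h)⁻¹) := by
    intro g h k
    rw [← hν g h k]
    apply Additive.ofMul.injective
    simp only [ofMul_mul, ofMul_inv]
    abel
  apply Additive.ofMul.injective
  unfold kk
  split_ifs with hg
  · simp only [hb, hg, mul_one, one_mul, ofMul_mul, ofMul_inv]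
    abel
  · simp only [hb, mul_assoc, pow4, mul_one, one_mul, ofMul_mul, ofMul_inv]
    abel

theorem kk_comp (ω : G → G → G → ℂˣ) (φ : G ≃* G) (g : G) :
    kk (fun x y z => ω (φ x) (φ y) (φ z)) g = kk ω (φ g) := by
  have : φ g * φ g = 1 ↔ g * g = 1 := by
    rw [← map_mul, map_eq_one_iff φ φ.injective]
  simp only [kk, this, map_mul, map_one]

/-- exponent of the invariant of a standard cocycle -/
def XX (p : Param) (g : G) : ℕ :=
  (if g * g = 1 then X p g 1 g + X p g g g
  else X p g 1 g + X p g g g + X p g (g * g) g + X p g (g * g * g) g) % 4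

theorem kk_std (p : Param) (g : G) : kk (std p) g = ζ ^ XX p g := by
  unfold kk XX
  rw [← ζ_mod]
  split_ifs <;> simp only [std, pow_add]

theorem XX_inj : ∀ p q : Param, XX p (dec 1) = XX q (dec 1) → XX p (dec 4) = XX q (dec 4) →
    XX p (dec 5) = XX q (dec 5) → p = q := by decide +kernel

abbrev Coc := {ω : G → G → G → ℂˣ // IsThreeCocycle ω}

noncomputable def stdC (p : Param) : Coc := ⟨std p, std_cocycle p⟩

theorem XX_lt (p : Param) (g : G) : XX p g % 4 = XX p g := Nat.mod_mod _ _

theorem move (φ : G ≃* G) (p q : Param) (h : ∀ g, XX p (φ g) = XX q g) :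
    AutCohomologousRel (stdC p) (stdC q) := by
  have hc : IsThreeCocycle fun x y z => std p (φ x) (φ y) (φ z) := by
    intro g h k l
    simpa only [map_mul] using std_cocycle p (φ g) (φ h) (φ k) (φ l)
  obtain ⟨r, hr⟩ := exists_std _ hc
  have hk : ∀ g, XX r g = XX q g := by
    intro g
    have := kk_coh hr g
    rw [kk_comp, kk_std, kk_std] at this
    have := ζ_inj this
    rw [XX_lt, XX_lt] at this
    rw [← this, h]
  have : r = q := XX_inj r q (hk _) (hk _) (hk _)
  subst this
  exact ⟨φ, hr⟩

def φ1 : G ≃* G where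
  toFun g := dec (enc g % 4 + 4 * ((enc g / 4 + enc g % 4) % 2))
  invFun g := dec (enc g % 4 + 4 * ((enc g / 4 + enc g % 4) % 2))
  left_inv := by unfold Function.LeftInverse; decide
  right_inv := by unfold Function.RightInverse Function.LeftInverse; decide
  map_mul' := by decide

def φ2 : G ≃* G where
  toFun g := dec ((enc g + 2 * (enc g / 4)) % 4 + 4 * (enc g / 4))
  invFun g := dec ((enc g + 2 * (enc g / 4)) % 4 + 4 * (enc g / 4))
  left_inv := by unfold Function.LeftInverse; decide
  right_inv := by unfold Function.RightInverse Function.LeftInverse; decide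
  map_mul' := by decide

def σ1 (p : Param) : Param := (p.1 + Fin.ofNat 4 (2 * p.2.2.val), p.2.1, p.2.2)
def σ2 (p : Param) : Param := (p.1, Fin.ofNat 2 (p.1.val + p.2.1.val + p.2.2.val), p.2.2)

theorem rel1 (p : Param) : AutCohomologousRel (stdC p) (stdC (σ1 p)) := by
  apply move φ1
  revert p
  decide +kernel

theorem rel2 (p : Param) : AutCohomologousRel (stdC p) (stdC (σ2 p)) := by
  apply move φ2
  revert p
  decide +kernel

/-- the nine representatives -/
def rep : Fin 9 → Param := ![(0, 0, 0), (0, 1, 0), (2, 0, 0), (2, 1, 0), (1, 0, 0), (3, 0, 0),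
  (0, 0, 1), (1, 0, 1), (1, 1, 1)]

theorem rep_surj : ∀ p : Param, ∃ i, rep i = p ∨ rep i = σ1 p ∨ rep i = σ2 p ∨
    rep i = σ1 (σ2 p) := by decide +kernel

/-- the full invariant of a cocycle under automorphisms -/
noncomputable def K (ω : Coc) : Multiset (Bool × ℂˣ) :=
  (Finset.univ : Finset G).val.map fun g => (decide (g * g = 1), kk ω.1 g)

theorem K_rel (a b : Coc) (h : AutCohomologousRel a b) : K a = K b := by
  obtain ⟨φ, hφ⟩ := h
  have hk : ∀ g, kk b.1 g = kk a.1 (φ g) := by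
    intro g
    rw [← kk_comp]
    exact (kk_coh (a := fun x y z => a.1 (φ x) (φ y) (φ z)) hφ g).symm
  have hd : ∀ g : G, (g * g = 1) ↔ (φ g * φ g = 1) := by
    intro g
    rw [← map_mul, map_eq_one_iff φ φ.injective]
  unfold K
  simp only [hk]
  have hu : (Finset.univ : Finset G).val = (Finset.univ : Finset G).val.map φ := by
    have := congrArg Finset.val (Finset.map_univ_equiv φ.toEquiv)
    rw [Finset.map_val] at this
    exact this.symm
  conv_lhs => rw [hu, Multiset.map_map]
  apply Multiset.map_congr rfl
  intro g _
  simp only [Function.comp, hd g]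

def K0 (p : Param) : Multiset (Bool × ℕ) :=
  (Finset.univ : Finset G).val.map fun g => (decide (g * g = 1), XX p g)

def cnt (p : Param) : List ℕ :=
  [(K0 p).count (true, 0), (K0 p).count (false, 0), (K0 p).count (false, 1),
    (K0 p).count (false, 2)]

theorem K0_rep : ∀ i j : Fin 9, cnt (rep i) = cnt (rep j) → i = j := by decide +kernel

theorem K_std (p : Param) (b : Bool) (n : Fin 4) :
    (K0 p).count (b, n.val) = (K (stdC p)).count (b, ζ ^ n.val) := by
  have e : K (stdC p) = (K0 p).map fun t => (t.1, ζ ^ t.2) := by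
    unfold K K0
    rw [Multiset.map_map]
    simp only [stdC, kk_std, Function.comp_def]
  rw [e]
  unfold K0
  rw [Multiset.map_map, Multiset.count_map, Multiset.count_map]
  congr 1
  apply Multiset.filter_congr
  intro g _
  simp only [Function.comp, Prod.mk.injEq]
  refine and_congr_right fun _ => ⟨fun h => by rw [h], fun h => ?_⟩
  have := ζ_inj h
  rw [XX_lt, Nat.mod_eq_of_lt n.isLt] at this
  exact this

theorem cnt_eq (p q : Param) (h : K (stdC p) = K (stdC q)) : cnt p = cnt q := by
  have : ∀ (b : Bool) (n : Fin 4), (K0 p).count (b, n.val) = (K0 q).count (b, n.val) := by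
    intro b n
    rw [K_std, K_std, h]
  have h0 := this true 0
  have h1 := this false 0
  have h2 := this false 1
  have h3 := this false 2
  simp only [cnt]
  simp only [Fin.val_zero, Fin.val_one] at h0 h1 h2
  rw [h0, h1, h2]
  exact congrArg (fun t => [_, _, _, t]) h3

theorem card_nine : Nat.card (Quot (AutCohomologousRel (G := G))) = 9 := by
  have hb : Function.Bijective fun i : Fin 9 => Quot.mk (AutCohomologousRel (G := G)) (stdC (rep i)) := by
    constructor
    · intro i j hij
      have := congrArg (Quot.lift K K_rel) hij
      exact K0_rep i j (cnt_eq _ _ this)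
    · intro q
      induction q using Quot.ind with
      | mk ω =>
      obtain ⟨p, hp⟩ := exists_std ω.1 ω.2
      have e0 : Quot.mk (AutCohomologousRel (G := G)) ω = Quot.mk _ (stdC p) :=
        Quot.sound ⟨MulEquiv.refl G, hp⟩
      have e1 : ∀ p, Quot.mk (AutCohomologousRel (G := G)) (stdC p) = Quot.mk _ (stdC (σ1 p)) :=
        fun p => Quot.sound (rel1 p)
      have e2 : ∀ p, Quot.mk (AutCohomologousRel (G := G)) (stdC p) = Quot.mk _ (stdC (σ2 p)) :=
        fun p => Quot.sound (rel2 p)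
      obtain ⟨i, hi | hi | hi | hi⟩ := rep_surj p
      · exact ⟨i, by simp only [hi, e0]⟩
      · exact ⟨i, by simp only [hi, e0, ← e1]⟩
      · exact ⟨i, by simp only [hi, e0, ← e2]⟩
      · exact ⟨i, by simp only [hi, e0, ← e1, ← e2]⟩
  rw [← Nat.card_congr (Equiv.ofBijective _ hb), Nat.card_fin]

end HThree

/-- The pullback action of `Aut(ℤ/4ℤ × ℤ/2ℤ)` on `H³(ℤ/4ℤ × ℤ/2ℤ, ℂˣ)` has exactly
`9` orbits. -/
theorem card_orbits_autAction_H3_Z4xZ2 :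
    Nat.card
      (Quot (AutCohomologousRel (G := Multiplicative (ZMod 4 × ZMod 2)))) = 9 := by
  exact HThree.card_nine
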